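/- Let A, B be unital C*-algebras and φ: A → B a linear positive map (φ maps positive elements to positive elements). Then ‖φ‖ = ‖φ(1_A)‖. (Russo–Dye theorem for positive maps.) -/

import Mathlib

open scoped InnerProductSpace ComplexOrder

/-- Norm bound for a combination of positive elements with unimodular coefficients. -/
theorem rd_sum_bound {B : Type*} [CStarAlgebra B] [PartialOrder B] [StarOrderedRing B]
    {ι : Type*} [Fintype ι] (c : ι → ℂ) (hc : ∀ i, ‖c i‖ = 1) (b : ι → B) (hb : ∀ i, 0 ≤ b i) :
    ‖∑ i, c i • b i‖ ≤ ‖∑ i, b i‖ := by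
  let x : WithCStarModule B (ι → B) := (WithCStarModule.equiv B (ι → B)).symm
    (fun i => CFC.sqrt (b i))
  let y : WithCStarModule B (ι → B) := (WithCStarModule.equiv B (ι → B)).symm
    (fun i => c i • CFC.sqrt (b i))
  have hs : ∀ i, star (CFC.sqrt (b i)) = CFC.sqrt (b i) := fun i =>
    (CFC.sqrt_nonneg (b i)).isSelfAdjoint
  have hm : ∀ i, CFC.sqrt (b i) * CFC.sqrt (b i) = b i := fun i =>
    CFC.sqrt_mul_sqrt_self (b i) (hb i)
  have hcc : ∀ i, c i * star (c i) = 1 := fun i => by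
    have := Complex.mul_conj' (c i)
    rw [hc i] at this
    simpa using this
  have hcc' : ∀ i, star (c i) * c i = 1 := fun i => by rw [mul_comm, hcc]
  have hxx : ⟪x, x⟫_B = ∑ i, b i := by
    rw [WithCStarModule.pi_inner]
    refine Finset.sum_congr rfl fun i _ => ?_
    simp [x, WithCStarModule.inner_def, hs, hm]
  have hyy : ⟪y, y⟫_B = ∑ i, b i := by
    rw [WithCStarModule.pi_inner]
    refine Finset.sum_congr rfl fun i _ => ?_
    simp only [y, WithCStarModule.equiv_symm_pi_apply, WithCStarModule.inner_def, star_smul,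
      smul_mul_smul_comm, hs, hm, hcc, hcc', one_smul]
  have hxy : ⟪x, y⟫_B = ∑ i, c i • b i := by
    rw [WithCStarModule.pi_inner]
    refine Finset.sum_congr rfl fun i _ => ?_
    simp only [x, y, WithCStarModule.equiv_symm_pi_apply, WithCStarModule.inner_def,
      smul_mul_assoc, mul_smul_comm, hs, hm]
  have h := CStarModule.norm_inner_le (A := B) (WithCStarModule B (ι → B)) (x := x) (y := y)
  have h1 := CStarModule.norm_sq_eq B (x := x)
  have h2 := CStarModule.norm_sq_eq B (x := y)
  rw [hxx] at h1
  rw [hyy] at h2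
  rw [hxy] at h
  nlinarith [sq_nonneg (‖x‖ - ‖y‖)]

theorem rd_unitary {A B : Type*} [CStarAlgebra A] [PartialOrder A] [StarOrderedRing A]
    [CStarAlgebra B] [PartialOrder B] [StarOrderedRing B]
    (φ : A →L[ℂ] B) (hφ : ∀ a : A, 0 ≤ a → 0 ≤ φ a) (u : A) (hu : u ∈ unitary A) :
    ‖φ u‖ ≤ ‖φ 1‖ := by
  have key : ∀ ε > 0, ‖φ u‖ ≤ ‖φ 1‖ + ‖φ‖ * ε := by
    intro ε hε
    have hn : IsStarNormal u := by
      rw [Unitary.mem_iff] at hu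
      exact ⟨by rw [Commute, SemiconjBy, hu.1, hu.2]⟩
    have hsp : spectrum ℂ u ⊆ Metric.sphere 0 1 := spectrum.subset_circle_of_unitary hu
    obtain ⟨t, hts, htf, hcov⟩ := (isCompact_sphere (0 : ℂ) 1).finite_cover_balls hε
    have := htf.fintype
    let g : t → ℂ → ℝ := fun i z => max 0 (ε - ‖z - i‖)
    have hg0 : ∀ i z, 0 ≤ g i z := fun i z => le_max_left _ _
    have hgc : ∀ i, Continuous (g i) := fun i => by fun_prop
    let S : ℂ → ℝ := fun z => ∑ i, g i z
    have hSc : Continuous S := by fun_prop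
    have hS : ∀ z ∈ spectrum ℂ u, 0 < S z := by
      intro z hz
      obtain ⟨i, hi, hzi⟩ := Set.mem_iUnion₂.1 (hcov (hsp hz))
      refine Finset.sum_pos' (fun i _ => hg0 i z) ⟨⟨i, hi⟩, Finset.mem_univ _, ?_⟩
      rw [Metric.mem_ball, dist_eq_norm] at hzi
      exact lt_max_of_lt_right (by simpa using hzi)
    let f : t → ℂ → ℂ := fun i z => ((g i z / S z : ℝ) : ℂ)
    have hfc : ∀ i, ContinuousOn (f i) (spectrum ℂ u) := fun i =>
      Complex.continuous_ofReal.comp_continuousOn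
        ((hgc i).continuousOn.div hSc.continuousOn fun z hz => (hS z hz).ne')
    have hr1 : ∀ z ∈ spectrum ℂ u, ∑ i, g i z / S z = 1 := fun z hz => by
      rw [← Finset.sum_div]; exact div_self (hS z hz).ne'
    have hf1 : ∀ z ∈ spectrum ℂ u, ∑ i, f i z = 1 := fun z hz => by
      have := hr1 z hz
      simp only [f]
      exact_mod_cast this
    let p : t → A := fun i => cfc (f i) u
    have hp0 : ∀ i, 0 ≤ p i := fun i => cfc_nonneg fun z hz => by
      simp only [f]
      exact_mod_cast div_nonneg (hg0 i z) (hS z hz).le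
    have hp1 : ∑ i, p i = 1 := by
      rw [← cfc_sum_univ f u hfc, ← cfc_one ℂ u]
      refine cfc_congr fun z hz => ?_
      simpa using hf1 z hz
    have hcomb : ∑ i : t, (i : ℂ) • p i = cfc (fun z => ∑ i : t, (i : ℂ) * f i z) u := by
      have : (fun z => ∑ i : t, (i : ℂ) * f i z) = ∑ i : t, (fun z => (i : ℂ) * f i z) := by
        ext; simp
      rw [this, cfc_sum_univ (fun (i : t) z => (i : ℂ) * f i z) u (fun i => continuousOn_const.mul (hfc i))]
      exact Finset.sum_congr rfl fun i _ => (cfc_const_mul _ _ _ (hfc i)).symm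
    have hdiff : ‖u - ∑ i : t, (i : ℂ) • p i‖ ≤ ε := by
      have hcc : ContinuousOn (fun z => ∑ i : t, (i : ℂ) * f i z) (spectrum ℂ u) :=
        continuousOn_finsetSum _ fun i _ => continuousOn_const.mul (hfc i)
      have : u - ∑ i : t, (i : ℂ) • p i = cfc (fun z => z - ∑ i : t, (i : ℂ) * f i z) u := by
        rw [hcomb, cfc_sub (fun z => z) _ u continuousOn_id hcc, cfc_id' ℂ u]
      rw [this]
      refine norm_cfc_le hε.le fun z hz => ?_
      have e : z - ∑ i : t, (i : ℂ) * f i z = ∑ i : t, (z - i) * f i z := by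
        simp only [sub_mul, Finset.sum_sub_distrib, ← Finset.mul_sum, hf1 z hz, mul_one]
      rw [e]
      calc ‖∑ i : t, (z - i) * f i z‖ ≤ ∑ i : t, ‖(z - i) * f i z‖ := norm_sum_le _ _
        _ ≤ ∑ i : t, ε * (g i z / S z) := by
          refine Finset.sum_le_sum fun i _ => ?_
          have hq : 0 ≤ g i z / S z := div_nonneg (hg0 i z) (hS z hz).le
          rw [norm_mul, Complex.norm_of_nonneg hq]
          rcases le_or_gt ‖z - i‖ ε with h | h
          · gcongr
          · have : g i z = 0 := max_eq_left (by linarith)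
            simp [this]
        _ = ε := by rw [← Finset.mul_sum, hr1 z hz, mul_one]
    have hb := rd_sum_bound (fun i : t => (i : ℂ)) (fun i => by simpa using hts i.2)
      (fun i => φ (p i)) (fun i => hφ _ (hp0 i))
    have e1 : ∑ i, φ (p i) = φ 1 := by rw [← map_sum, hp1]
    have e2 : ∑ i : t, (i : ℂ) • φ (p i) = φ (∑ i : t, (i : ℂ) • p i) := by simp [map_sum]
    rw [e1, e2] at hb
    calc ‖φ u‖ = ‖φ (∑ i : t, (i : ℂ) • p i) + φ (u - ∑ i : t, (i : ℂ) • p i)‖ := by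
          rw [← map_add, add_sub_cancel]
      _ ≤ ‖φ (∑ i : t, (i : ℂ) • p i)‖ + ‖φ (u - ∑ i : t, (i : ℂ) • p i)‖ := norm_add_le _ _
      _ ≤ ‖φ 1‖ + ‖φ‖ * ε := add_le_add hb (φ.le_opNorm_of_le hdiff)
  refine le_of_forall_pos_le_add fun δ hδ => ?_
  have hpos : 0 < ‖φ‖ + 1 := by positivity
  refine (key (δ / (‖φ‖ + 1)) (by positivity)).trans ?_
  gcongr
  rw [mul_div_assoc', div_le_iff₀ hpos]
  nlinarith

/-- Gardner's lemma. -/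
theorem rd_gardner {A : Type*} [CStarAlgebra A] [PartialOrder A] [StarOrderedRing A]
    (u a : A) (hu : u ∈ unitary A) (ha : ‖a‖ < 1) :
    ∃ v ∈ unitary A, ∃ w ∈ unitary A, u + a = v + w := by
  rcases subsingleton_or_nontrivial A with hA | hA
  · exact ⟨1, one_mem _, 1, one_mem _, Subsingleton.elim _ _⟩
  have hun : ‖u‖ = 1 := CStarRing.norm_of_mem_unitary hu
  have hun' : ‖star u‖ = 1 := by rw [norm_star, hun]
  have hu' := Unitary.mem_iff.1 hu
  let x : A := (2⁻¹ : ℂ) • (u + a)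
  have hxn : ‖x‖ ≤ 1 := by
    simp only [x, norm_smul]
    have := norm_add_le u a
    norm_num
    linarith
  have hxu : IsUnit x := by
    have h1 : IsUnit (1 - (-(star u * a))) := by
      apply isUnit_one_sub_of_norm_lt_one
      rw [norm_neg]
      calc ‖star u * a‖ ≤ ‖star u‖ * ‖a‖ := norm_mul_le _ _
        _ < 1 := by rw [hun', one_mul]; exact ha
    have h2 : IsUnit u := ⟨⟨u, star u, hu'.2, hu'.1⟩, rfl⟩
    have h3 : u + a = u * (1 - (-(star u * a))) := by
      rw [sub_neg_eq_add, mul_add, ← mul_assoc, hu'.2, mul_one, one_mul]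
    have h4 : IsUnit (u + a) := by rw [h3]; exact h2.mul h1
    have h5 : x = algebraMap ℂ A 2⁻¹ * (u + a) := Algebra.smul_def _ _
    rw [h5]
    exact ((IsUnit.mk0 (2⁻¹ : ℂ) (by norm_num)).map (algebraMap ℂ A)).mul h4
  let h : A := CFC.abs x
  have hh : IsSelfAdjoint h := (CFC.abs_nonneg x).isSelfAdjoint
  have hhn : ‖h‖ ≤ 1 := by rw [CFC.norm_abs]; exact hxn
  have hhu : IsUnit h := by
    have : IsUnit (h * h) := by
      rw [CFC.abs_mul_abs]; exact hxu.star.mul hxu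
    exact ((Commute.refl h).isUnit_mul_iff.1 this).1
  obtain ⟨k, hk⟩ := hhu
  have hks : star (↑k⁻¹ : A) = ↑k⁻¹ := by
    have : star k = k := by ext; simp [hk, hh.star_eq]
    rw [← Units.coe_star_inv, this]
  have hv : x * ↑k⁻¹ ∈ unitary A := by
    refine IsUnit.mem_unitary_of_star_mul_self (hxu.mul (Units.isUnit _)) ?_
    rw [star_mul, hks, mul_assoc, ← mul_assoc (star x), ← CFC.abs_mul_abs x]
    change ↑k⁻¹ * (h * h * ↑k⁻¹) = 1
    rw [← hk]; simp
  have hw := hh.self_add_I_smul_cfcSqrt_sub_sq_mem_unitary h hhn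
  set w := h + Complex.I • CFC.sqrt (1 - h ^ 2) with hwdef
  refine ⟨_, mul_mem hv hw, _, mul_mem hv (Unitary.star_mem hw), ?_⟩
  have hsum : w + star w = (2 : ℂ) • h := by
    have hq : star (CFC.sqrt (1 - h ^ 2)) = CFC.sqrt (1 - h ^ 2) :=
      (CFC.sqrt_nonneg (1 - h ^ 2)).isSelfAdjoint
    rw [hwdef, star_add, hh.star_eq, star_smul, hq]
    simp only [two_smul, Complex.star_def, Complex.conj_I, neg_smul]
    abel
  rw [← mul_add, hsum, mul_smul_comm, mul_assoc, ← hk]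
  simp [x, smul_smul]

theorem rd_main {A B : Type*} [CStarAlgebra A] [PartialOrder A] [StarOrderedRing A]
    [CStarAlgebra B] [PartialOrder B] [StarOrderedRing B]
    (φ : A →L[ℂ] B) (hφ : ∀ a : A, 0 ≤ a → 0 ≤ φ a) :
    ‖φ‖ = ‖φ 1‖ := by
  have step : ∀ a : A, ‖a‖ < 1 → ∀ n : ℕ, ∀ u ∈ unitary A,
      ‖φ (u + n • a)‖ ≤ (n + 1) * ‖φ 1‖ := by
    intro a ha n
    induction n with
    | zero => intro u hu; simpa using rd_unitary φ hφ u hu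
    | succ n ih =>
      intro u hu
      obtain ⟨v, hv, w, hw, e⟩ := rd_gardner u a hu ha
      have : u + (n + 1) • a = v + (w + n • a) := by
        rw [← add_assoc, ← e, add_smul, one_smul]; abel
      rw [this, map_add]
      have h1 := rd_unitary φ hφ v hv
      have h2 := ih w hw
      have h3 := norm_add_le (φ v) (φ (w + n • a))
      push_cast
      linarith
  have ball : ∀ a : A, ‖a‖ < 1 → ‖φ a‖ ≤ ‖φ 1‖ := by
    intro a ha
    have hn : ∀ n : ℕ, n * (‖φ a‖ - ‖φ 1‖) ≤ 2 * ‖φ 1‖ := by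
      intro n
      have h1 := step a ha n 1 (one_mem _)
      have h2 : ‖φ (n • a)‖ ≤ ‖φ (1 + n • a)‖ + ‖φ 1‖ := by
        have := norm_sub_le (φ (1 + n • a)) (φ 1)
        rwa [← map_sub, add_sub_cancel_left] at this
      rw [map_nsmul, ← Nat.cast_smul_eq_nsmul ℝ, norm_smul, Real.norm_natCast] at h2
      linarith
    by_contra! hlt
    obtain ⟨n, hn'⟩ := exists_nat_gt (2 * ‖φ 1‖ / (‖φ a‖ - ‖φ 1‖))
    rw [div_lt_iff₀ (sub_pos.2 hlt)] at hn'
    linarith [hn n]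
  apply le_antisymm
  · refine φ.opNorm_le_bound (norm_nonneg _) fun a => ?_
    refine le_of_forall_pos_le_add fun δ hδ => ?_
    have hpos : 0 < ‖φ 1‖ + 1 := by positivity
    let r : ℝ := ‖a‖ + δ / (‖φ 1‖ + 1)
    have hδ' : 0 < δ / (‖φ 1‖ + 1) := by positivity
    have hr : 0 < r := by positivity
    have hb := ball (((r⁻¹ : ℝ) : ℂ) • a) (by
      rw [norm_smul, Complex.norm_of_nonneg (by positivity), inv_mul_lt_iff₀ hr, mul_one]
      exact lt_add_of_pos_right _ hδ')
    rw [map_smul, norm_smul, Complex.norm_of_nonneg (by positivity), inv_mul_le_iff₀ hr] at hb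
    refine hb.trans ?_
    have : δ / (‖φ 1‖ + 1) * ‖φ 1‖ ≤ δ := by
      rw [div_mul_eq_mul_div, div_le_iff₀ hpos]; nlinarith
    simp only [r]
    nlinarith
  · rcases subsingleton_or_nontrivial A with hA | hA
    · rw [Subsingleton.elim (1 : A) 0]; simp
    · simpa using φ.le_opNorm 1

/-- **Russo–Dye.** Let `A`, `B` be unital C*-algebras and
`φ : A → B` a positive linear map (it maps positive elements to positive
elements).  Then `‖φ‖ = ‖φ(1_A)‖`. -/
theorem russo_dye_positive_map
    (A : Type*) [NormedRing A] [StarRing A] [CStarRing A] [CompleteSpace A]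
    [NormedAlgebra ℂ A] [StarModule ℂ A] [PartialOrder A] [StarOrderedRing A]
    (B : Type*) [NormedRing B] [StarRing B] [CStarRing B] [CompleteSpace B]
    [NormedAlgebra ℂ B] [StarModule ℂ B] [PartialOrder B] [StarOrderedRing B]
    (φ : A →L[ℂ] B) (hφ : ∀ a : A, 0 ≤ a → 0 ≤ φ a) :
    ‖φ‖ = ‖φ 1‖ := by
  letI : CStarAlgebra A := {}
  letI : CStarAlgebra B := {}
  exact rd_main φ hφ
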